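/- For a finite simple graph G, the set of eigenvalues of the adjacency tensor A(G^{k,k/2}) equals the union, over all nonempty subsets U ⊆ V with the induced subgraph G[U] connected and all diagonal matrices E = diag(ε_u)_{u∈U} whose entries are k-th roots of unity, of the sets of eigenvalues of the complex matrices E·A_U·E; and the set of H-eigenvalues of A(G^{k,k/2}) equals the union, over all nonempty U ⊆ V with G[U] connected, of the sets of eigenvalues of the real symmetric matrices A_U. -/

import Mathlib

open scoped BigOperators
open Matrix

/-- `lam` is an eigenvalue of the adjacency tensor `A(G^{k,k/2})` of the generalized power
hypergraph `G^{k,k/2}` with eigenvector `x`. -/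
def IsAdjEigenpair {V : Type*} [Fintype V] [DecidableEq V] (k s : ℕ)
    (G : SimpleGraph V) [DecidableRel G.Adj]
    (lam : ℂ) (x : V × Fin s → ℂ) : Prop :=
  x ≠ 0 ∧ ∀ (u : V) (v : Fin s),
    lam * x (u, v) ^ (k - 1) =
      ∑ w ∈ G.neighborFinset u,
        (∏ p ∈ Finset.univ.erase v, x (u, p)) * ∏ q : Fin s, x (w, q)

/-- The eigenvalue equations over a general field. -/
def EigEqs {V K : Type*} [Fintype V] [DecidableEq V] [Field K] (s : ℕ)
    (G : SimpleGraph V) [DecidableRel G.Adj] (lam : K) (x : V × Fin s → K) : Prop :=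
  x ≠ 0 ∧ ∀ (u : V) (v : Fin s),
    lam * x (u, v) ^ (2 * s - 1) =
      ∑ w ∈ G.neighborFinset u,
        (∏ p ∈ Finset.univ.erase v, x (u, p)) * ∏ q : Fin s, x (w, q)

lemma exists_component {V K : Type*} [Fintype V] [DecidableEq V] [Field K]
    (G : SimpleGraph V) [DecidableRel G.Adj] (z : V → K) (u0 : V) (h0 : z u0 ≠ 0) :
    ∃ U : Finset V, U.Nonempty ∧ (G.induce (↑U : Set V)).Connected ∧
      (∀ u ∈ U, z u ≠ 0) ∧ ∀ u ∈ U, ∀ w, G.Adj u w → w ∉ U → z w = 0 := by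
  classical
  let H : SimpleGraph V :=
    { Adj := fun u w => G.Adj u w ∧ z u ≠ 0 ∧ z w ≠ 0
      symm := ⟨fun u w h => ⟨h.1.symm, h.2.2, h.2.1⟩⟩
      loopless := ⟨fun u h => G.loopless.irrefl u h.1⟩ }
  let C := H.connectedComponentMk u0
  have hmem : ∀ u, u ∈ C.supp → z u ≠ 0 := by
    intro u hu
    have hr : H.Reachable u0 u := (SimpleGraph.ConnectedComponent.exact hu).symm
    rw [SimpleGraph.reachable_iff_reflTransGen] at hr
    cases hr with
    | refl => exact h0
    | tail _ h => exact h.2.2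
  refine ⟨C.supp.toFinset, ⟨u0, by simp [C]⟩, ?_, ?_, ?_⟩
  · rw [Set.coe_toFinset]
    have h1 : (H.induce C.supp).Connected := C.connected_toSimpleGraph
    refine h1.mono ?_
    intro a b hab
    exact hab.1
  · intro u hu
    exact hmem u (by simpa using hu)
  · intro u hu w hw hwU
    by_contra hz
    apply hwU
    have hu' : u ∈ C.supp := by simpa using hu
    have : H.Adj u w := ⟨hw, hmem u hu', hz⟩
    have : w ∈ C.supp := by
      rw [SimpleGraph.ConnectedComponent.mem_supp_iff] at hu' ⊢
      rw [← hu']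
      exact SimpleGraph.ConnectedComponent.sound this.reachable.symm
    simpa using this

lemma eig_fwd {V K : Type*} [Fintype V] [DecidableEq V] [Field K] (s : ℕ) (hs : 2 ≤ s)
    (G : SimpleGraph V) [DecidableRel G.Adj] (lam : K) (hl : lam ≠ 0) (x : V × Fin s → K)
    (hx : EigEqs s G lam x) :
    ∃ U : Finset V, U.Nonempty ∧ (G.induce (↑U : Set V)).Connected ∧
      ∃ z b : V → K, ∀ u ∈ U, z u ≠ 0 ∧ b u ≠ 0 ∧ (z u ^ 2) ^ s = ((b u ^ s) ^ 2) ^ s ∧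
        lam * (b u ^ s) ^ 2 = z u * ∑ w : {w // w ∈ U}, if G.Adj u w then z w else 0 := by
  obtain ⟨hx0, hE⟩ := hx
  let z : V → K := fun u => ∏ q : Fin s, x (u, q)
  have key : ∀ u v, lam * x (u, v) ^ (2 * s) = z u * ∑ w ∈ G.neighborFinset u, z w := by
    intro u v
    have h1 := hE u v
    rw [← Finset.mul_sum] at h1
    have h2 : z u = x (u, v) * ∏ p ∈ Finset.univ.erase v, x (u, p) :=
      (Finset.mul_prod_erase _ _ (Finset.mem_univ v)).symm
    have h3 : x (u, v) ^ (2 * s) = x (u, v) ^ (2 * s - 1) * x (u, v) := by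
      rw [← pow_succ]; congr 1; omega
    rw [h2, h3, ← mul_assoc, h1]
    ring
  have hconst : ∀ u v v', x (u, v) ^ (2 * s) = x (u, v') ^ (2 * s) := by
    intro u v v'
    exact mul_left_cancel₀ hl ((key u v).trans (key u v').symm)
  have hzpow : ∀ u v, (z u) ^ (2 * s) = (x (u, v) ^ (2 * s)) ^ s := by
    intro u v
    simp only [z]
    rw [← Finset.prod_pow, Finset.prod_congr rfl (fun q _ => hconst u q v)]
    simp
  obtain ⟨⟨u0, v0⟩, hne⟩ : ∃ p, x p ≠ 0 := by
    by_contra h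
    push Not at h
    exact hx0 (funext h)
  have hz0 : z u0 ≠ 0 := by
    intro h
    have := hzpow u0 v0
    rw [h, zero_pow (by omega)] at this
    exact pow_ne_zero _ (pow_ne_zero _ hne) this.symm
  obtain ⟨U, hU, hconn, hUz, hUn⟩ := exists_component G z u0 hz0
  refine ⟨U, hU, hconn, z, fun u => x (u, v0), fun u hu => ⟨hUz u hu, ?_, ?_, ?_⟩⟩
  · intro h
    apply hUz u hu
    exact Finset.prod_eq_zero (Finset.mem_univ v0) h
  · rw [← pow_mul, hzpow u v0]
    ring
  · have : (x (u, v0) ^ s) ^ 2 = x (u, v0) ^ (2 * s) := by ring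
    rw [this, key u v0]
    congr 1
    rw [Finset.sum_coe_sort U (fun w => if G.Adj u w then z w else 0), ← Finset.sum_filter]
    symm
    apply Finset.sum_subset
    · intro w hw
      simp at hw ⊢
      exact hw.2
    · intro w hw hw2
      simp at hw hw2
      exact hUn u hu w hw (fun h => hw2 h hw)

lemma eig_zero {V K : Type*} [Fintype V] [DecidableEq V] [Field K] (s : ℕ) (hs : 2 ≤ s)
    (G : SimpleGraph V) [DecidableRel G.Adj] (u0 : V) :
    ∃ x : V × Fin s → K, EigEqs s G 0 x := by
  refine ⟨Pi.single (u0, ⟨0, by omega⟩) 1, ?_, ?_⟩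
  · simp
  · intro u v
    rw [zero_mul]
    symm
    apply Finset.sum_eq_zero
    intro w _
    apply mul_eq_zero_of_right
    apply Finset.prod_eq_zero (Finset.mem_univ (⟨1, by omega⟩ : Fin s))
    simp [Pi.single_apply]

lemma eig_bwd {V K : Type*} [Fintype V] [DecidableEq V] [Field K] (s : ℕ) (hs : 2 ≤ s)
    (G : SimpleGraph V) [DecidableRel G.Adj] (lam : K) (z a e : V → K) (hz : z ≠ 0)
    (he : ∀ u, e u ^ (2 * s) = 1) (ha : ∀ u, a u ^ s * e u = z u)
    (hE : ∀ u, z u ≠ 0 → lam * z u = e u ^ 2 * ∑ w ∈ G.neighborFinset u, z w) :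
    ∃ x : V × Fin s → K, EigEqs s G lam x := by
  have he0 : ∀ u, e u ≠ 0 := by
    intro u h
    have := he u
    rw [h, zero_pow (by omega)] at this
    exact zero_ne_one this
  let v0 : Fin s := ⟨0, by omega⟩
  let x : V × Fin s → K := fun p => a p.1 * (if p.2 = v0 then e p.1 else 1)
  have hP : ∀ u, ∏ q : Fin s, x (u, q) = z u := by
    intro u
    simp only [x]
    rw [Finset.prod_mul_distrib, Finset.prod_ite_eq' Finset.univ v0]
    simp [ha]
  have hpow : ∀ u v, x (u, v) ^ (2 * s) = a u ^ (2 * s) := by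
    intro u v
    simp only [x]
    rw [mul_pow]
    split_ifs <;> simp [he]
  refine ⟨x, ?_, ?_⟩
  · intro h
    apply hz
    funext u
    rw [← hP u, h]
    simp
    omega
  · intro u v
    simp only [hP]
    rw [← Finset.mul_sum]
    by_cases hu : z u = 0
    · have hau : a u = 0 := by
        have := ha u
        rw [hu] at this
        exact pow_eq_zero_iff (by omega) |>.1 ((mul_eq_zero.1 this).resolve_right (he0 u))
      have hxu : ∀ q, x (u, q) = 0 := by intro q; simp [x, hau]
      obtain ⟨q, hq⟩ : ∃ q : Fin s, q ≠ v := by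
        haveI : Nontrivial (Fin s) := Fin.nontrivial_iff_two_le.2 hs
        exact exists_ne v
      rw [hxu, zero_pow (by omega), mul_zero,
        Finset.prod_eq_zero (Finset.mem_erase.2 ⟨hq, Finset.mem_univ q⟩) (hxu q), zero_mul]
    · have h2 : x (u, v) * ∏ p ∈ Finset.univ.erase v, x (u, p) = z u := by
        rw [← hP u]
        exact (Finset.mul_prod_erase _ (fun p => x (u, p)) (Finset.mem_univ v))
      have hxne : x (u, v) ≠ 0 := by
        intro h
        rw [h, zero_mul] at h2
        exact hu h2.symm
      apply mul_left_cancel₀ hxne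
      rw [← mul_assoc (x (u, v)) (∏ p ∈ _, _), h2]
      have h3 : x (u, v) * (lam * x (u, v) ^ (2 * s - 1)) = lam * x (u, v) ^ (2 * s) := by
        have : x (u, v) ^ (2 * s) = x (u, v) ^ (2 * s - 1) * x (u, v) := by
          rw [← pow_succ]; congr 1; omega
        rw [this]; ring
      rw [h3, hpow]
      apply mul_left_cancel₀ (pow_ne_zero 2 (he0 u))
      calc e u ^ 2 * (lam * a u ^ (2 * s)) = (lam * (a u ^ s * e u)) * (a u ^ s * e u) := by ring
        _ = (e u ^ 2 * ∑ w ∈ G.neighborFinset u, z w) * z u := by rw [ha, hE u hu]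
        _ = _ := by ring

lemma ext_sum {V K : Type*} [Fintype V] [DecidableEq V] [Field K]
    (G : SimpleGraph V) [DecidableRel G.Adj] (U : Finset V) (y : {u // u ∈ U} → K) (u : V) :
    ∑ w ∈ G.neighborFinset u, (if h : w ∈ U then y ⟨w, h⟩ else 0) =
      ∑ w : {w // w ∈ U}, if G.Adj u w then y w else 0 := by
  have h1 : (∑ w : {w // w ∈ U}, if G.Adj u w then y w else 0) =
      ∑ w : {w // w ∈ U}, (fun w : V => if G.Adj u w then
        (if h : w ∈ U then y ⟨w, h⟩ else 0) else 0) w := by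
    apply Finset.sum_congr rfl
    intro w _
    simp
  rw [h1, Finset.sum_coe_sort U (fun w : V => if G.Adj u w then
        (if h : w ∈ U then y ⟨w, h⟩ else 0) else 0), ← Finset.sum_filter]
  symm
  apply Finset.sum_subset
  · intro w hw
    simp at hw ⊢
    exact hw.2
  · intro w hw hw2
    simp at hw hw2
    rw [dif_neg (fun h => hw2 h hw)]

lemma mulVec_adj {V K : Type*} [Fintype V] [DecidableEq V] [Field K]
    (G : SimpleGraph V) [DecidableRel G.Adj] (U : Finset V) (y : {u // u ∈ U} → K)
    (u : {u // u ∈ U}) :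
    (((G.adjMatrix K).submatrix Subtype.val Subtype.val) *ᵥ y) u =
      ∑ w : {w // w ∈ U}, if G.Adj u w then y w else 0 := by
  simp only [Matrix.mulVec, dotProduct, Matrix.submatrix_apply, SimpleGraph.adjMatrix_apply,
    ite_mul, one_mul, zero_mul]

lemma mulVec_diag {V K : Type*} [Fintype V] [DecidableEq V] [Field K]
    (G : SimpleGraph V) [DecidableRel G.Adj] (U : Finset V) (e y : {u // u ∈ U} → K)
    (u : {u // u ∈ U}) :
    ((Matrix.diagonal e * (G.adjMatrix K).submatrix Subtype.val Subtype.val *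
                Matrix.diagonal e) *ᵥ y) u =
      e u * ∑ w : {w // w ∈ U}, if G.Adj u w then e w * y w else 0 := by
  rw [← Matrix.mulVec_mulVec, ← Matrix.mulVec_mulVec, Matrix.mulVec_diagonal, mulVec_adj]
  simp only [Matrix.mulVec_diagonal]

lemma conn_single {V : Type*} [DecidableEq V] (G : SimpleGraph V) (u0 : V) :
    (G.induce (↑({u0} : Finset V) : Set V)).Connected := by
  haveI : Nonempty (↑(↑({u0} : Finset V) : Set V)) := ⟨⟨u0, by simp⟩⟩
  haveI : Subsingleton (↑(↑({u0} : Finset V) : Set V)) :=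
    ⟨fun a b => Subtype.ext (by have := a.2; have := b.2; simp_all)⟩
  exact ⟨SimpleGraph.Preconnected.of_subsingleton⟩

lemma mulVec_single_zero {V K : Type*} [Fintype V] [DecidableEq V] [Field K]
    (G : SimpleGraph V) [DecidableRel G.Adj] (u0 : V) (y : {u // u ∈ ({u0} : Finset V)} → K)
    (u : {u // u ∈ ({u0} : Finset V)}) :
    ∑ w : {w // w ∈ ({u0} : Finset V)}, (if G.Adj u w then y w else 0) = 0 := by
  apply Finset.sum_eq_zero
  rintro ⟨w, hw⟩ _
  obtain ⟨u, hu⟩ := u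
  simp at hw hu
  subst hw
  subst hu
  simp

/-- The set of eigenvalues of the adjacency tensor `A(G^{k,k/2})` equals the union, over all
nonempty `U ⊆ V` with `G[U]` connected and all diagonal matrices `E = diag(ε)` with
`k`-th-root-of-unity entries, of the sets of eigenvalues of `E·A_U·E`;
and the set of `H`-eigenvalues of `A(G^{k,k/2})` equals the union, over all nonempty `U` with
`G[U]` connected, of the sets of eigenvalues of the real symmetric matrices `A_U`. -/
theorem stmt11 {V : Type*} [Fintype V] [DecidableEq V] (k s : ℕ)
    (hk : 4 ≤ k) (hks : k = 2 * s) (G : SimpleGraph V) [DecidableRel G.Adj] :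
    ({lam : ℂ | ∃ x : V × Fin s → ℂ, IsAdjEigenpair k s G lam x} =
      {lam : ℂ | ∃ U : Finset V, U.Nonempty ∧ (G.induce (↑U : Set V)).Connected ∧
        ∃ eps : {u // u ∈ U} → ℂ, (∀ u, eps u ^ k = 1) ∧
          ∃ y : {u // u ∈ U} → ℂ, y ≠ 0 ∧
            (Matrix.diagonal eps * (G.adjMatrix ℂ).submatrix Subtype.val Subtype.val *
                Matrix.diagonal eps) *ᵥ y = lam • y}) ∧
    ({lam : ℝ | ∃ x : V × Fin s → ℝ,
        IsAdjEigenpair k s G (lam : ℂ) (fun v => (x v : ℂ))} =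
      {lam : ℝ | ∃ U : Finset V, U.Nonempty ∧ (G.induce (↑U : Set V)).Connected ∧
        ∃ y : {u // u ∈ U} → ℝ, y ≠ 0 ∧
          ((G.adjMatrix ℝ).submatrix Subtype.val Subtype.val) *ᵥ y = lam • y}) := by
  subst hks
  have hs : 2 ≤ s := by omega
  refine ⟨?_, ?_⟩
  · ext lam
    simp only [Set.mem_ofPred_eq]
    constructor
    · rintro ⟨x, hx⟩
      have hx' : EigEqs s G lam x := hx
      by_cases hl : lam = 0
      · obtain ⟨⟨u0, v0⟩, hne⟩ : ∃ p, x p ≠ 0 := by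
          by_contra h
          push Not at h
          exact hx.1 (funext h)
        refine ⟨{u0}, by simp, conn_single G u0, fun _ => 1, by simp, fun _ => 1, ?_, ?_⟩
        · intro h
          exact one_ne_zero (congrFun h ⟨u0, by simp⟩)
        · funext u
          rw [mulVec_diag, mulVec_single_zero G u0 (fun _ => 1 * 1) u, hl]
          simp
      · obtain ⟨U, hU, hconn, z, b, h⟩ := eig_fwd s hs G lam hl x hx'
        have hb : ∀ u : {u // u ∈ U}, b u ^ s ≠ 0 := fun u => pow_ne_zero _ (h u u.2).2.1
        have hz : ∀ u : {u // u ∈ U}, z u ≠ 0 := fun u => (h u u.2).1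
        refine ⟨U, hU, hconn, fun u => z u / b u ^ s, ?_, fun u => b u ^ s, ?_, ?_⟩
        · intro u
          rw [pow_mul, div_pow, div_pow, (h u u.2).2.2.1]
          exact div_self (pow_ne_zero _ (pow_ne_zero _ (hb u)))
        · intro h0
          obtain ⟨u, hu⟩ := hU
          exact hb ⟨u, hu⟩ (congrFun h0 ⟨u, hu⟩)
        · funext u
          rw [mulVec_diag]
          have h4 := (h u u.2).2.2.2
          have : (∑ w : {w // w ∈ U}, if G.Adj u w then z w / b w ^ s * b w ^ s else 0) =
              ∑ w : {w // w ∈ U}, if G.Adj u w then z w else 0 := by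
            apply Finset.sum_congr rfl
            intro w _
            rw [div_mul_cancel₀ _ (hb w)]
          rw [this, div_mul_eq_mul_div, ← h4, Pi.smul_apply, smul_eq_mul,
            div_eq_iff (hb u)]
          ring
    · rintro ⟨U, ⟨u0, hu0⟩, -, e, he, y, hy, hE⟩
      by_cases hl : lam = 0
      · subst hl
        exact eig_zero s hs G u0
      · have he0 : ∀ u, e u ≠ 0 := by
          intro u h
          have := he u
          rw [h, zero_pow (by omega)] at this
          exact zero_ne_one this
        let e' : V → ℂ := fun u => if h : u ∈ U then e ⟨u, h⟩ else 1
        let z : V → ℂ := fun u => if h : u ∈ U then e ⟨u, h⟩ * y ⟨u, h⟩ else 0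
        have he' : ∀ u, e' u ^ (2 * s) = 1 := by
          intro u
          simp only [e']
          split_ifs
          · exact he _
          · simp
        have he0' : ∀ u, e' u ≠ 0 := by
          intro u h
          have := he' u
          rw [h, zero_pow (by omega)] at this
          exact zero_ne_one this
        have hroot : ∀ u, ∃ a : ℂ, a ^ s = z u / e' u := fun u =>
          IsAlgClosed.exists_pow_nat_eq _ (by omega)
        choose a ha using hroot
        refine eig_bwd s hs G lam z a e' ?_ he' ?_ ?_
        · intro h
          apply hy
          funext u
          have h1 := congrFun h u
          simp only [z, u.2, dif_pos, Pi.zero_apply, mul_eq_zero] at h1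
          exact h1.resolve_left (he0 _)
        · intro u
          rw [ha, div_mul_cancel₀ _ (he0' u)]
        · intro u hu
          have huU : u ∈ U := by
            by_contra h
            exact hu (by simp [z, h])
          have h1 := congrFun hE ⟨u, huU⟩
          rw [mulVec_diag, Pi.smul_apply, smul_eq_mul] at h1
          have h2 := ext_sum G U (fun w => e w * y w) u
          simp only [z]
          rw [h2]
          simp only [e', huU, dif_pos]
          linear_combination (-e ⟨u, huU⟩) * h1
  · have hcast : ∀ (lam : ℝ) (x : V × Fin s → ℝ),
        IsAdjEigenpair (2 * s) s G (lam : ℂ) (fun v => (x v : ℂ)) ↔ EigEqs s G lam x := by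
      intro lam x
      unfold IsAdjEigenpair EigEqs
      apply and_congr
      · apply not_congr
        simp [funext_iff]
      · apply forall_congr'; intro u
        apply forall_congr'; intro v
        beta_reduce
        norm_cast
    ext lam
    simp only [Set.mem_ofPred_eq, hcast]
    constructor
    · rintro ⟨x, hx⟩
      by_cases hl : lam = 0
      · obtain ⟨⟨u0, v0⟩, hne⟩ : ∃ p, x p ≠ 0 := by
          by_contra h
          push Not at h
          exact hx.1 (funext h)
        refine ⟨{u0}, by simp, conn_single G u0, fun _ => 1, ?_, ?_⟩
        · intro h
          exact one_ne_zero (congrFun h ⟨u0, by simp⟩)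
        · funext u
          rw [mulVec_adj, mulVec_single_zero G u0 (fun _ => 1) u, hl]
          simp
      · obtain ⟨U, hU, hconn, z, b, h⟩ := eig_fwd s hs G lam hl x hx
        refine ⟨U, hU, hconn, fun u => z u, ?_, ?_⟩
        · intro h0
          obtain ⟨u, hu⟩ := hU
          exact (h u hu).1 (congrFun h0 ⟨u, hu⟩)
        · funext u
          rw [mulVec_adj]
          obtain ⟨h1, h2, h3, h4⟩ := h u u.2
          have h5 : z u ^ 2 = (b u ^ s) ^ 2 :=
            (pow_left_inj₀ (sq_nonneg _) (sq_nonneg _) (by omega)).1 h3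
          apply mul_left_cancel₀ h1
          rw [← h4, ← h5, Pi.smul_apply, smul_eq_mul]
          ring
    · rintro ⟨U, ⟨u0, hu0⟩, -, y, hy, hE⟩
      by_cases hl : lam = 0
      · subst hl
        exact eig_zero s hs G u0
      · let z : V → ℝ := fun u => if h : u ∈ U then y ⟨u, h⟩ else 0
        let e' : V → ℝ := fun u => if 0 ≤ z u then 1 else -1
        have he2 : ∀ u, e' u ^ 2 = 1 := by
          intro u
          simp only [e']
          split_ifs <;> simp
        have hze : ∀ u, |z u| * e' u = z u := by
          intro u
          simp only [e']
          split_ifs with h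
          · rw [abs_of_nonneg h, mul_one]
          · rw [abs_of_neg (not_le.1 h)]; ring
        refine eig_bwd s hs G lam z (fun u => |z u| ^ ((s : ℝ)⁻¹)) e' ?_ ?_ ?_ ?_
        · intro h
          apply hy
          funext u
          have h1 := congrFun h u
          simpa only [z, u.2, dif_pos, Pi.zero_apply] using h1
        · intro u
          rw [pow_mul, he2, one_pow]
        · intro u
          rw [Real.rpow_inv_natCast_pow (abs_nonneg _) (by omega), hze]
        · intro u hu
          have huU : u ∈ U := by
            by_contra h
            exact hu (by simp [z, h])
          have h1 := congrFun hE ⟨u, huU⟩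
          rw [mulVec_adj, Pi.smul_apply, smul_eq_mul] at h1
          have h2 := ext_sum G U y u
          rw [he2, one_mul]
          simp only [z]
          rw [h2, dif_pos huU]
          exact h1.symm
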